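/- There exists a pre-flow temporal network N = ((V ∪ {s}, A), τ) on 5 vertices (including s) with 7 arcs whose underlying directed graph contains a directed cycle, such that there is no packing of 2 τ-respecting s-arborescences in which each vertex v ∈ V belongs to at least min{2, λ_N(s,v)} of them. Hence the acyclicity condition cannot be dropped from the theorem stating that in an acyclic pre-flow temporal network there is a packing of k τ-respecting s-arborescences with each vertex v in min{k, λ_N(s,v)} of them. -/

import Mathlib

/-- A directed graph (possibly with parallel arcs): arc type `At`, vertex type `Vt`,
each arc has a tail and a head. -/
structure Dgraph (Vt At : Type) where
  tail : At → Vt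
  head : At → Vt

namespace Dgraph

variable {Vt At : Type}

/-- `D.WalkFrom u p v` : the list of arcs `p` forms a directed walk from `u` to `v`. -/
def WalkFrom (D : Dgraph Vt At) : Vt → List At → Vt → Prop
  | u, [], v => u = v
  | u, a :: p, v => D.tail a = u ∧ D.WalkFrom (D.head a) p v

/-- The vertices visited by a walk starting at `u` with arc list `p`. -/
def walkVerts (D : Dgraph Vt At) (u : Vt) (p : List At) : List Vt :=
  u :: p.map D.head

/-- A directed path from `u` to `v`: a walk visiting pairwise distinct vertices. -/
def IsPath (D : Dgraph Vt At) (u : Vt) (p : List At) (v : Vt) : Prop :=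
  D.WalkFrom u p v ∧ (D.walkVerts u p).Nodup

/-- An arc list is τ-respecting if its τ-values are non-decreasing. -/
def Respects (τ : At → ℕ) (p : List At) : Prop :=
  List.Chain' (· ≤ ·) (p.map τ)

/-- An arc list is monochromatic w.r.t. a colouring `c` if all its arcs get the same colour. -/
def Monochromatic (c : At → Bool) (p : List At) : Prop :=
  ∀ a ∈ p, ∀ b ∈ p, c a = c b

/-- There is no directed cycle using only arcs of `B`
(equivalently, no nonempty closed directed walk inside `B`). -/
def AcyclicOn (D : Dgraph Vt At) (B : Set At) : Prop :=
  ¬ ∃ (v : Vt) (p : List At), p ≠ [] ∧ (∀ a ∈ p, a ∈ B) ∧ D.WalkFrom v p v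

/-- The directed graph contains no directed cycle. -/
def Acyclic (D : Dgraph Vt At) : Prop :=
  D.AcyclicOn Set.univ

/-- `u` reaches `v` by a directed walk. -/
def Reaches (D : Dgraph Vt At) (u v : Vt) : Prop :=
  ∃ p : List At, D.WalkFrom u p v

/-- `u` and `v` are in the same strongly connected component. -/
def MutuallyReachable (D : Dgraph Vt At) (u v : Vt) : Prop :=
  D.Reaches u v ∧ D.Reaches v u

/-- A temporal network `(D, τ)` is consistent if any two arcs lying in the same strongly
connected component (i.e. whose endpoints are all mutually reachable) have the same τ-value. -/
def Consistent (D : Dgraph Vt At) (τ : At → ℕ) : Prop :=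
  ∀ a b : At,
    D.MutuallyReachable (D.tail a) (D.head a) →
    D.MutuallyReachable (D.tail b) (D.head b) →
    D.MutuallyReachable (D.tail a) (D.tail b) →
    τ a = τ b

section Fin

variable [DecidableEq Vt] [Fintype At]

/-- The vertex set of the subgraph with arc set `B`, together with the root `s`. -/
def vertsF (D : Dgraph Vt At) (s : Vt) (B : Finset At) : Finset Vt :=
  insert s (B.image D.tail ∪ B.image D.head)

/-- In-degree of `v` in the subgraph with arc set `B`. -/
def indegOn (D : Dgraph Vt At) (B : Finset At) (v : Vt) : ℕ :=
  (B.filter (fun a => D.head a = v)).card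

/-- In-degree of `v`. -/
def indeg (D : Dgraph Vt At) (v : Vt) : ℕ :=
  D.indegOn Finset.univ v

/-- Out-degree of `v`. -/
def outdeg (D : Dgraph Vt At) (v : Vt) : ℕ :=
  (Finset.univ.filter (fun a => D.tail a = v)).card

/-- `ρ^i_N(v)` : the set of arcs entering `v` with τ-value at most `i`. -/
def rhoLe (D : Dgraph Vt At) (τ : At → ℕ) (v : Vt) (i : ℕ) : Finset At :=
  Finset.univ.filter (fun a => D.head a = v ∧ τ a ≤ i)

/-- `δ^i_N(v)` : the set of arcs leaving `v` with τ-value at most `i`. -/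
def deltaLe (D : Dgraph Vt At) (τ : At → ℕ) (v : Vt) (i : ℕ) : Finset At :=
  Finset.univ.filter (fun a => D.tail a = v ∧ τ a ≤ i)

/-- The temporal network `(D, τ)` with root `s` is pre-flow:
`|ρ^i_N(v)| ≥ |δ^i_N(v)|` for every `i` and every non-root vertex `v`. -/
def Preflow (D : Dgraph Vt At) (τ : At → ℕ) (s : Vt) : Prop :=
  ∀ (i : ℕ) (v : Vt), v ≠ s → (D.deltaLe τ v i).card ≤ (D.rhoLe τ v i).card

/-- The arc set `B` induces an `s`-arborescence: the subgraph contains `s`,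
has no directed cycle, and every vertex of it other than `s` has in-degree exactly 1. -/
def IsArb (D : Dgraph Vt At) (s : Vt) (B : Finset At) : Prop :=
  D.AcyclicOn (↑B) ∧ ∀ v ∈ D.vertsF s B, v ≠ s → D.indegOn B v = 1

/-- The arc set `B` induces a τ-respecting `s`-arborescence: an `s`-arborescence in which,
for every vertex `v` of the arborescence, the (unique) path from `s` to `v` is τ-respecting. -/
def IsTArb (D : Dgraph Vt At) (τ : At → ℕ) (s : Vt) (B : Finset At) : Prop :=
  D.IsArb s B ∧
    ∀ v ∈ D.vertsF s B, ∀ p : List At, (∀ a ∈ p, a ∈ B) → D.IsPath s p v → Respects τ p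

/-- There exist `k` pairwise arc-disjoint τ-respecting directed paths from `s` to `v`. -/
def HasTPaths (D : Dgraph Vt At) (τ : At → ℕ) (s v : Vt) (k : ℕ) : Prop :=
  ∃ P : Fin k → List At,
    (∀ i, D.IsPath s (P i) v ∧ Respects τ (P i)) ∧
    ∀ i j, i ≠ j → ∀ a, a ∈ P i → a ∉ P j

/-- `λ_N(s,v)` : the maximum number of pairwise arc-disjoint τ-respecting `(s,v)`-paths. -/
noncomputable def lambdaT (D : Dgraph Vt At) (τ : At → ℕ) (s v : Vt) : ℕ :=
  sSup {k | D.HasTPaths τ s v k}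

/-- `λ_D(s,v)` : the maximum number of pairwise arc-disjoint `(s,v)`-paths. -/
noncomputable def lambda (D : Dgraph Vt At) (s v : Vt) : ℕ :=
  D.lambdaT (fun _ => 0) s v

end Fin

end Dgraph

namespace Dgraph

instance decidableWalkFrom {Vt At : Type} [DecidableEq Vt] (D : Dgraph Vt At) :
    ∀ (u : Vt) (p : List At) (v : Vt), Decidable (D.WalkFrom u p v)
  | u, [], v => inferInstanceAs (Decidable (u = v))
  | u, a :: p, v =>
    haveI := decidableWalkFrom D (D.head a) p v
    inferInstanceAs (Decidable (D.tail a = u ∧ D.WalkFrom (D.head a) p v))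

instance decidableIsPath {Vt At : Type} [DecidableEq Vt] (D : Dgraph Vt At) (u : Vt)
    (p : List At) (v : Vt) : Decidable (D.IsPath u p v) :=
  inferInstanceAs (Decidable (D.WalkFrom u p v ∧ (D.walkVerts u p).Nodup))

instance decidableRespects {At : Type} (τ : At → ℕ) (p : List At) : Decidable (Respects τ p) :=
  inferInstanceAs (Decidable (List.IsChain (· ≤ ·) (p.map τ)))

section Packing

variable {Vt At : Type}

/-- Pairwise arc-disjoint paths to a vertex other than the root are at most as many as the arcs. -/
theorem HasTPaths.le_card [Fintype At] {D : Dgraph Vt At} {τ : At → ℕ} {s v : Vt} {k : ℕ} (hv : v ≠ s)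
    (h : D.HasTPaths τ s v k) : k ≤ Fintype.card At := by
  obtain ⟨P, hP, hdisj⟩ := h
  have hne : ∀ i, P i ≠ [] := by
    intro i hi
    have hw := (hP i).1.1
    rw [hi] at hw
    exact hv hw.symm
  have hinj : Function.Injective fun i => (P i).head (hne i) := by
    intro i j hij
    by_contra hne'
    refine hdisj i j hne' _ (List.head_mem (hne i)) ?_
    have hh : (P i).head (hne i) = (P j).head (hne j) := hij
    rw [hh]
    exact List.head_mem _
  simpa using Fintype.card_le_of_injective _ hinj

theorem HasTPaths.le_lambdaT [Fintype At] {D : Dgraph Vt At} {τ : At → ℕ} {s v : Vt} {k : ℕ} (hv : v ≠ s)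
    (h : D.HasTPaths τ s v k) : k ≤ D.lambdaT τ s v :=
  le_csSup ⟨Fintype.card At, fun _ hk => hk.le_card hv⟩ h

theorem hasTPaths_two {D : Dgraph Vt At} {τ : At → ℕ} {s v : Vt} {p q : List At}
    (hp : D.IsPath s p v) (hp' : Respects τ p) (hq : D.IsPath s q v) (hq' : Respects τ q)
    (hpq : ∀ a ∈ p, a ∉ q) : D.HasTPaths τ s v 2 := by
  refine ⟨![p, q], ?_, ?_⟩
  · intro i
    fin_cases i
    exacts [⟨hp, hp'⟩, ⟨hq, hq'⟩]
  · intro i j hij a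
    fin_cases i <;> fin_cases j <;> simp at hij ⊢
    exacts [hpq a, fun h h' => hpq a h' h]

/-- If a packing of two arborescences covers `v` as required and two arc-disjoint time-respecting
paths lead to `v`, then `v` lies in both arborescences. -/
theorem mem_vertsF_of_hasTPaths_two [DecidableEq Vt] [Fintype At] {D : Dgraph Vt At} {τ : At → ℕ} {s v : Vt}
    {B : Fin 2 → Finset At} (hv : v ≠ s) (h : D.HasTPaths τ s v 2)
    (hB : min 2 (D.lambdaT τ s v) ≤
      (Finset.univ.filter (fun i => v ∈ D.vertsF s (B i))).card) (i : Fin 2) :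
    v ∈ D.vertsF s (B i) := by
  rw [min_eq_left (h.le_lambdaT hv)] at hB
  have huniv : Finset.univ.filter (fun i => v ∈ D.vertsF s (B i)) = Finset.univ :=
    Finset.eq_univ_of_card _ (le_antisymm (Finset.card_le_univ _) (by simpa using hB))
  have hi := Finset.mem_univ i
  rw [← huniv] at hi
  exact (Finset.mem_filter.1 hi).2

theorem IsArb.exists_head_eq [DecidableEq Vt] {D : Dgraph Vt At} {s v : Vt} {B : Finset At} (h : D.IsArb s B)
    (hv : v ∈ D.vertsF s B) (hvs : v ≠ s) : ∃ a ∈ B, D.head a = v := by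
  have hcard : 0 < (B.filter (fun a => D.head a = v)).card := by
    have := h.2 v hv hvs
    unfold indegOn at this
    omega
  obtain ⟨a, ha⟩ := Finset.card_pos.1 hcard
  exact ⟨a, (Finset.mem_filter.1 ha).1, (Finset.mem_filter.1 ha).2⟩

theorem tail_mem_vertsF [DecidableEq Vt] {D : Dgraph Vt At} {s : Vt} {B : Finset At} {a : At} (ha : a ∈ B) :
    D.tail a ∈ D.vertsF s B :=
  Finset.mem_insert_of_mem (Finset.mem_union_left _ (Finset.mem_image_of_mem _ ha))

theorem head_mem_vertsF [DecidableEq Vt] {D : Dgraph Vt At} {s : Vt} {B : Finset At} {a : At} (ha : a ∈ B) :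
    D.head a ∈ D.vertsF s B :=
  Finset.mem_insert_of_mem (Finset.mem_union_right _ (Finset.mem_image_of_mem _ ha))

theorem IsArb.not_closed_walk [DecidableEq Vt] {D : Dgraph Vt At} {s v : Vt} {B : Finset At} (h : D.IsArb s B)
    {p : List At} (hp : p ≠ []) (hw : D.WalkFrom v p v) : ¬ ∀ a ∈ p, a ∈ B :=
  fun hB => h.1 ⟨v, p, hp, hB, hw⟩

theorem IsTArb.not_path [DecidableEq Vt] {D : Dgraph Vt At} {τ : At → ℕ} {s : Vt} {B : Finset At}
    (h : D.IsTArb τ s B) {p : List At} {a : At} (ha : a ∈ p) (hw : D.IsPath s p (D.head a))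
    (hτ : ¬ Respects τ p) : ¬ ∀ b ∈ p, b ∈ B :=
  fun hB => hτ (h.2 _ (head_mem_vertsF (hB a ha)) p hB hw)

end Packing

/-- A digraph rooted at `0`, with the cycle `1 → 2 → 3 → 1`. -/
def cyclicExample : Dgraph (Fin 5) (Fin 7) where
  tail := ![0, 1, 0, 3, 4, 3, 2]
  head := ![3, 2, 2, 4, 1, 1, 3]

/-- The time labels on the arcs of `cyclicExample`. -/
def cyclicExampleTime : Fin 7 → ℕ := ![1, 2, 2, 1, 3, 2, 2]

theorem preflow_cyclicExample : cyclicExample.Preflow cyclicExampleTime 0 := by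
  intro i v hv
  have hsmall : ∀ j : Fin 4, ∀ w : Fin 5, w ≠ 0 →
      (cyclicExample.deltaLe cyclicExampleTime w j).card ≤
        (cyclicExample.rhoLe cyclicExampleTime w j).card := by decide
  have hle : ∀ a, cyclicExampleTime a ≤ 3 := by decide
  have hiff : ∀ a, cyclicExampleTime a ≤ i ↔ cyclicExampleTime a ≤ min i 3 := fun a => by
    have := hle a
    omega
  simpa only [deltaLe, rhoLe, hiff] using hsmall ⟨min i 3, by omega⟩ v hv

theorem not_acyclic_cyclicExample : ¬ cyclicExample.Acyclic :=
  not_not.2 ⟨1, [1, 6, 5], by decide, fun _ _ => Set.mem_univ _, by decide⟩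

/-- Membership of arcs in a time-respecting arborescence of `cyclicExample` that contains the
vertices `1`, `2` and `3`. -/
theorem IsTArb.cyclicExample_arcs {B : Finset (Fin 7)}
    (h : cyclicExample.IsTArb cyclicExampleTime 0 B)
    (h1 : 1 ∈ cyclicExample.vertsF 0 B) (h2 : 2 ∈ cyclicExample.vertsF 0 B)
    (h3 : 3 ∈ cyclicExample.vertsF 0 B) :
    ((4 ∈ B ∨ 5 ∈ B) ∧ (1 ∈ B ∨ 2 ∈ B) ∧ (0 ∈ B ∨ 6 ∈ B) ∧ (4 ∈ B → 3 ∈ B)) ∧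
    ¬ (5 ∈ B ∧ 1 ∈ B ∧ 6 ∈ B) ∧ ¬ (6 ∈ B ∧ 3 ∈ B ∧ 4 ∈ B ∧ 1 ∈ B) ∧
    ¬ (0 ∈ B ∧ 3 ∈ B ∧ 4 ∈ B ∧ 1 ∈ B) ∧ ¬ (2 ∈ B ∧ 6 ∈ B ∧ 3 ∈ B) := by
  have in1 : ∀ a, cyclicExample.head a = 1 → a = 4 ∨ a = 5 := by decide
  have in2 : ∀ a, cyclicExample.head a = 2 → a = 1 ∨ a = 2 := by decide
  have in3 : ∀ a, cyclicExample.head a = 3 → a = 0 ∨ a = 6 := by decide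
  have in4 : ∀ a, cyclicExample.head a = 4 → a = 3 := by decide
  refine ⟨⟨?_, ?_, ?_, ?_⟩, ?_, ?_, ?_, ?_⟩
  · obtain ⟨a, ha, hh⟩ := h.1.exists_head_eq h1 (by decide)
    rcases in1 a hh with rfl | rfl <;> simp [ha]
  · obtain ⟨a, ha, hh⟩ := h.1.exists_head_eq h2 (by decide)
    rcases in2 a hh with rfl | rfl <;> simp [ha]
  · obtain ⟨a, ha, hh⟩ := h.1.exists_head_eq h3 (by decide)
    rcases in3 a hh with rfl | rfl <;> simp [ha]
  · intro h4
    obtain ⟨a, ha, hh⟩ := h.1.exists_head_eq (v := 4) (tail_mem_vertsF h4) (by decide)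
    exact in4 a hh ▸ ha
  · simpa using h.1.not_closed_walk (v := 3) (p := [5, 1, 6]) (by decide) (by decide)
  · simpa using h.1.not_closed_walk (v := 2) (p := [6, 3, 4, 1]) (by decide) (by decide)
  · simpa using h.not_path (p := [0, 3, 4, 1]) (a := 1) (by decide) (by decide) (by decide)
  · simpa using h.not_path (p := [2, 6, 3]) (a := 3) (by decide) (by decide) (by decide)

end Dgraph

/-- There exists a pre-flow temporal network on `5` vertices (including the
root `s`) with `7` arcs, whose underlying directed graph contains a directed cycle, such
that there is no packing of `2` τ-respecting `s`-arborescences in which every vertex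
`v ∈ V` belongs to at least `min {2, λ_N(s,v)}` of them. -/
theorem exists_cyclic_preflow_counterexample :
    ∃ (D : Dgraph (Fin 5) (Fin 7)) (τ : Fin 7 → ℕ) (s : Fin 5),
      (∀ a : Fin 7, D.head a ≠ s) ∧
      D.Preflow τ s ∧
      ¬ D.Acyclic ∧
      ¬ ∃ B : Fin 2 → Finset (Fin 7),
          (∀ i, D.IsTArb τ s (B i)) ∧
          (∀ i j, i ≠ j → Disjoint (B i) (B j)) ∧
          ∀ v : Fin 5, v ≠ s →
            min 2 (D.lambdaT τ s v) ≤
              (Finset.univ.filter (fun i => v ∈ D.vertsF s (B i))).card := by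
  refine ⟨Dgraph.cyclicExample, Dgraph.cyclicExampleTime, 0, by decide,
    Dgraph.preflow_cyclicExample, Dgraph.not_acyclic_cyclicExample, ?_⟩
  rintro ⟨B, hB, hdisj, hcov⟩
  have h1 := Dgraph.mem_vertsF_of_hasTPaths_two (v := 1) (by decide)
    (Dgraph.hasTPaths_two (p := [0, 3, 4]) (q := [2, 6, 5]) (by decide) (by decide) (by decide)
      (by decide) (by decide)) (hcov 1 (by decide))
  have h2 := Dgraph.mem_vertsF_of_hasTPaths_two (v := 2) (by decide)
    (Dgraph.hasTPaths_two (p := [2]) (q := [0, 5, 1]) (by decide) (by decide) (by decide)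
      (by decide) (by decide)) (hcov 2 (by decide))
  have h3 := Dgraph.mem_vertsF_of_hasTPaths_two (v := 3) (by decide)
    (Dgraph.hasTPaths_two (p := [0]) (q := [2, 6]) (by decide) (by decide) (by decide)
      (by decide) (by decide)) (hcov 3 (by decide))
  have arcs := fun i => (hB i).cyclicExample_arcs (h1 i) (h2 i) (h3 i)
  have hd : ∀ a, a ∈ B 0 → a ∉ B 1 := fun a ha =>
    Finset.disjoint_left.1 (hdisj 0 1 (by decide)) ha
  have a0 := arcs 0
  have a1 := arcs 1
  have d0 := hd 0
  have d1 := hd 1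
  have d2 := hd 2
  have d4 := hd 4
  have d5 := hd 5
  have d6 := hd 6
  clear hB hdisj hcov h1 h2 h3 arcs hd
  grind
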